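/- Let L be a finite lattice satisfying SD∨. Then L is dismantlable if and only if the breadth of L is at most two. -/

import Mathlib

/-- No irredundant join of three elements. -/
def NoTriple (L : Type*) [Lattice L] : Prop :=
  ∀ a b c : L, a ≤ b ⊔ c ∨ b ≤ a ⊔ c ∨ c ≤ a ⊔ b

theorem exists_irred_below {L : Type*} [Lattice L] [Finite L]
    (hSDj : ∀ a b c : L, a ⊔ b = a ⊔ c → a ⊔ b = a ⊔ (b ⊓ c)) (hT : NoTriple L) (t : L) :
    ∀ d < t, ∃ x ≤ t, ¬ x ≤ d ∧ (∀ a b, a ⊔ b = x → a = x ∨ b = x) ∧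
      (∀ a b, a ≤ t → b ≤ t → a ⊓ b = x → a = x ∨ b = x) := by
  have wf : WellFounded (fun a b : L => a < b) := wellFounded_lt
  induction t using wf.induction with
  | _ t ih =>
  intro d hd
  obtain ⟨d', hdd', hd'⟩ := exists_le_covBy_of_lt hd
  by_cases hall : ∀ y < t, y ≤ d'
  · refine ⟨t, le_rfl, not_le_of_gt hd, ?_, ?_⟩
    · intro a b hab
      by_contra hcon
      push Not at hcon
      have ha : a < t := lt_of_le_of_ne (hab ▸ le_sup_left) hcon.1
      have hb : b < t := lt_of_le_of_ne (hab ▸ le_sup_right) hcon.2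
      have : a ⊔ b ≤ d' := sup_le (hall a ha) (hall b hb)
      rw [hab] at this
      exact absurd hd'.lt (not_lt_of_ge this)
    · intro a b ha hb hab
      left
      exact le_antisymm ha (hab ▸ inf_le_left)
  · push Not at hall
    obtain ⟨y, hyt, hyd⟩ := hall
    obtain ⟨c, hyc, hc⟩ := exists_le_covBy_of_lt hyt
    have hcd : ¬ c ≤ d' := fun h => hyd (hyc.trans h)
    have hlt : c ⊓ d' < c := lt_of_le_of_ne inf_le_left (fun h => hcd (inf_eq_left.1 h))
    obtain ⟨x, hxc, hxd, hj, hm⟩ := ih c hc.lt (c ⊓ d') hlt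
    have hxd' : ¬ x ≤ d' := fun h => hxd (le_inf hxc h)
    refine ⟨x, hxc.trans hc.le, fun h => hxd' (h.trans hdd'), hj, ?_⟩
    have key : ∀ a, a ≤ t → a ≠ t → ¬ a ≤ d' → a ≤ c := by
      intro a hat hne had
      obtain ⟨e, hae, he⟩ := exists_le_covBy_of_lt (lt_of_le_of_ne hat hne)
      by_cases hec : e = c
      · exact hec ▸ hae
      exfalso
      have hed : e ≠ d' := fun h => had (h ▸ hae)
      have hcd2 : c ≠ d' := fun h => hcd h.le
      have sup_eq : ∀ u v : L, u ⋖ t → v ⋖ t → u ≠ v → u ⊔ v = t :=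
        fun u v hu hv huv => by
          by_contra hne
          have hlt : u ⊔ v < t := lt_of_le_of_ne (sup_le hu.le hv.le) hne
          have e1 : u = u ⊔ v := (hu.eq_or_eq le_sup_left hlt.le).elim Eq.symm (absurd · hne)
          have e2 : v = u ⊔ v := (hv.eq_or_eq le_sup_right hlt.le).elim Eq.symm (absurd · hne)
          exact huv (e1.trans e2.symm)
      have aux : ∀ u v w : L, u ⋖ t → v ⋖ t → w ⋖ t → u ≠ v → u ≠ w → ¬ v ⊓ w ≤ u := by
        intro u v w hu hv hw huv huw hle
        have h1 := hSDj u v w ((sup_eq u v hu hv huv).trans (sup_eq u w hu hw huw).symm)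
        rw [sup_eq u v hu hv huv, sup_eq_left.2 hle] at h1
        exact hu.lt.ne h1.symm
      rcases hT (c ⊓ d') (c ⊓ e) (d' ⊓ e) with h | h | h
      · exact aux e c d' he hc hd' hec hed (h.trans (sup_le inf_le_right inf_le_right))
      · exact aux d' c e hd' hc he hcd2.symm hed.symm
          (h.trans (sup_le inf_le_right inf_le_left))
      · exact aux c d' e hc hd' he hcd2 (Ne.symm hec)
          (h.trans (sup_le inf_le_left inf_le_left))
    intro a b ha hb hab
    have hxa : x ≤ a := hab ▸ inf_le_left
    have hxb : x ≤ b := hab ▸ inf_le_right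
    by_cases hat : a = t
    · right
      rw [← hab, hat, inf_eq_right.2 hb]
    by_cases hbt : b = t
    · left
      rw [← hab, hbt, inf_eq_left.2 ha]
    exact hm a b (key a ha hat fun h => hxd' (hxa.trans h))
      (key b hb hbt fun h => hxd' (hxb.trans h)) hab

theorem exists_doubly_irred {L : Type*} [Lattice L] [Finite L] [Nonempty L]
    (hSDj : ∀ a b c : L, a ⊔ b = a ⊔ c → a ⊔ b = a ⊔ (b ⊓ c)) (hT : NoTriple L) :
    ∃ x : L, (∀ a b, a ⊔ b = x → a = x ∨ b = x) ∧ (∀ a b, a ⊓ b = x → a = x ∨ b = x) := by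
  obtain ⟨t, ht⟩ : ∃ t : L, ∀ x, x ≤ t := by
    obtain ⟨t, ht⟩ := Finite.exists_le (fun x : L => x)
    exact ⟨t, ht⟩
  by_cases h : ∃ d, d < t
  · obtain ⟨d, hd⟩ := h
    obtain ⟨x, -, -, hj, hm⟩ := exists_irred_below hSDj hT t d hd
    exact ⟨x, hj, fun a b => hm a b (ht a) (ht b)⟩
  · have : ∀ a, a = t := fun a => by
      by_contra hne
      exact h ⟨a, lt_of_le_of_ne (ht a) hne⟩
    exact ⟨t, fun a _ _ => Or.inl (this a), fun a _ _ => Or.inl (this a)⟩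

theorem dismantle (n : ℕ) : ∀ (L : Type*) [Lattice L] [Finite L],
    (∀ a b c : L, a ⊔ b = a ⊔ c → a ⊔ b = a ⊔ (b ⊓ c)) → NoTriple L → Nat.card L = n →
    ∃ a : Fin n → L, Function.Bijective a ∧ ∀ k i j : Fin n, i ≤ k → j ≤ k →
      (∃ m ≤ k, a m = a i ⊔ a j) ∧ (∃ m ≤ k, a m = a i ⊓ a j) := by
  induction n with
  | zero =>
    intro L _ _ _ _ hc
    have : IsEmpty L := by
      rcases Nat.card_eq_zero.1 hc with h | h
      · exact h
      · exact absurd h (not_infinite_iff_finite.2 inferInstance)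
    exact ⟨fun i => i.elim0, ⟨fun i => i.elim0, fun x => isEmptyElim x⟩, fun k => k.elim0⟩
  | succ n ih =>
    intro L _ _ hSDj hT hc
    have : Nonempty L := (Nat.card_pos_iff.1 (by omega)).1
    obtain ⟨x, hj, hm⟩ := exists_doubly_irred hSDj hT
    letI : Lattice {y : L // y ≠ x} := Subtype.lattice
      (fun a b ha hb h => (hj a b h).elim ha hb) (fun a b ha hb h => (hm a b h).elim ha hb)
    have hs : ∀ a b : {y : L // y ≠ x}, ((a ⊔ b : {y : L // y ≠ x}) : L) = a.1 ⊔ b.1 :=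
      fun _ _ => rfl
    have hi : ∀ a b : {y : L // y ≠ x}, ((a ⊓ b : {y : L // y ≠ x}) : L) = a.1 ⊓ b.1 :=
      fun _ _ => rfl
    have hcard : Nat.card {y : L // y ≠ x} = n := by
      classical
      have := Fintype.ofFinite L
      rw [Nat.card_eq_fintype_card] at hc ⊢
      rw [Fintype.card_subtype_compl, hc]
      simp
    obtain ⟨a, ⟨hinj, hsurj⟩, ha⟩ := ih {y : L // y ≠ x}
      (fun a b c h => Subtype.ext (by
        have := congrArg Subtype.val h
        simp only [hs, hi] at this ⊢
        exact hSDj _ _ _ this))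
      (fun a b c => hT a.1 b.1 c.1) hcard
    have hsurj' : Function.Surjective (Fin.snoc (fun i => (a i).1) x : Fin (n+1) → L) := by
      intro y
      by_cases hy : y = x
      · exact ⟨Fin.last n, by simp [hy]⟩
      · obtain ⟨i, hi⟩ := hsurj ⟨y, hy⟩
        exact ⟨i.castSucc, by simp [hi]⟩
    refine ⟨Fin.snoc (fun i => (a i).1) x, ⟨?_, hsurj'⟩, ?_⟩
    · intro i j
      refine Fin.lastCases ?_ (fun i => ?_) i <;> refine Fin.lastCases ?_ (fun j => ?_) j
      · simp
      · simpa using fun h => absurd h.symm (a j).2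
      · simpa using fun h => absurd h (a i).2
      · simpa using fun h => hinj (Subtype.ext h)
    · intro k
      refine Fin.lastCases ?_ (fun k => ?_) k
      · intro i j _ _
        obtain ⟨m, hm⟩ := hsurj' ((Fin.snoc (fun i => (a i).1) x : Fin (n+1) → L) i ⊔
          (Fin.snoc (fun i => (a i).1) x : Fin (n+1) → L) j)
        obtain ⟨m', hm'⟩ := hsurj' ((Fin.snoc (fun i => (a i).1) x : Fin (n+1) → L) i ⊓
          (Fin.snoc (fun i => (a i).1) x : Fin (n+1) → L) j)
        exact ⟨⟨m, Fin.le_last _, hm⟩, ⟨m', Fin.le_last _, hm'⟩⟩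
      · intro i j
        refine Fin.lastCases ?_ (fun i => ?_) i
        · intro h
          exact absurd h (not_le_of_gt (Fin.castSucc_lt_last k))
        refine Fin.lastCases ?_ (fun j => ?_) j
        · intro _ h
          exact absurd h (not_le_of_gt (Fin.castSucc_lt_last k))
        intro hik hjk
        obtain ⟨⟨m, hmk, hm⟩, ⟨m', hmk', hm'⟩⟩ := ha k i j (by simpa using hik) (by simpa using hjk)
        refine ⟨⟨m.castSucc, by simpa using hmk, ?_⟩, ⟨m'.castSucc, by simpa using hmk', ?_⟩⟩
        · simp [hm, hs]
        · simp [hm', hi]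

/-- Breadth at most two (for joins) from the absence of irredundant triples. -/
theorem breadth_of_noTriple {L : Type*} [Lattice L] (hT : NoTriple L) (S : Finset L)
    (hS : S.Nonempty) : ∃ p ∈ S, ∃ q ∈ S, p ⊔ q = S.sup' hS id := by
  classical
  induction hS using Finset.Nonempty.cons_induction with
  | singleton a => exact ⟨a, by simp, a, by simp, by simp⟩
  | cons x s hx hs ih =>
    obtain ⟨p, hp, q, hq, h⟩ := ih
    rw [Finset.sup'_cons hs, ← h]
    rcases hT x p q with h | h | h
    · exact ⟨p, Finset.mem_cons.2 (Or.inr hp), q, Finset.mem_cons.2 (Or.inr hq),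
        (sup_eq_right.2 h).symm⟩
    · refine ⟨x, Finset.mem_cons.2 (Or.inl rfl), q, Finset.mem_cons.2 (Or.inr hq), ?_⟩
      exact le_antisymm (sup_le le_sup_left (le_sup_right.trans le_sup_right))
        (sup_le le_sup_left (sup_le h le_sup_right))
    · refine ⟨x, Finset.mem_cons.2 (Or.inl rfl), p, Finset.mem_cons.2 (Or.inr hp), ?_⟩
      exact le_antisymm (sup_le le_sup_left (le_sup_left.trans le_sup_right))
        (sup_le le_sup_left (sup_le le_sup_right h))

theorem noTriple_of_breadth {L : Type*} [Lattice L]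
    (h : ∀ (S : Finset L) (hS : S.Nonempty), ∃ (S' : Finset L) (hS' : S'.Nonempty),
        S' ⊆ S ∧ S'.card ≤ 2 ∧ S'.sup' hS' id = S.sup' hS id) : NoTriple L := by
  classical
  intro a b c
  obtain ⟨S', hS', hsub, hcard, hsup⟩ := h {a, b, c} (by simp)
  have hle : ∀ y ∈ ({a, b, c} : Finset L), y ≤ S'.sup' hS' id := by
    intro y hy
    rw [hsup]
    exact Finset.le_sup' id hy
  by_contra hcon
  push Not at hcon
  obtain ⟨h1, h2, h3⟩ := hcon
  have ha : a ∈ S' := by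
    by_contra hn
    refine h1 ((hle a (by simp)).trans (Finset.sup'_le _ _ fun y hy => ?_))
    have := hsub hy
    simp only [Finset.mem_insert, Finset.mem_singleton] at this
    rcases this with rfl | rfl | rfl
    · exact absurd hy hn
    · exact le_sup_left
    · exact le_sup_right
  have hb : b ∈ S' := by
    by_contra hn
    refine h2 ((hle b (by simp)).trans (Finset.sup'_le _ _ fun y hy => ?_))
    have := hsub hy
    simp only [Finset.mem_insert, Finset.mem_singleton] at this
    rcases this with rfl | rfl | rfl
    · exact le_sup_left
    · exact absurd hy hn
    · exact le_sup_right
  have hc : c ∈ S' := by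
    by_contra hn
    refine h3 ((hle c (by simp)).trans (Finset.sup'_le _ _ fun y hy => ?_))
    have := hsub hy
    simp only [Finset.mem_insert, Finset.mem_singleton] at this
    rcases this with rfl | rfl | rfl
    · exact le_sup_left
    · exact le_sup_right
    · exact absurd hy hn
  have hab : a ≠ b := fun e => h1 (e ▸ le_sup_left)
  have hac : a ≠ c := fun e => h1 (e ▸ le_sup_right)
  have hbc : b ≠ c := fun e => h2 (e ▸ le_sup_right)
  have : ({a, b, c} : Finset L).card ≤ S'.card := Finset.card_le_card (by
    intro y hy
    simp only [Finset.mem_insert, Finset.mem_singleton] at hy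
    rcases hy with rfl | rfl | rfl <;> assumption)
  rw [Finset.card_eq_three.2 ⟨a, b, c, hab, hac, hbc, rfl⟩] at this
  omega

/-- One step: if `T` and `insert x T` are sublattices and `T` has no irredundant triple,
then no irredundant triple of `insert x T` starts with `x`. -/
theorem step {L : Type*} [Lattice L] (T : Set L) (x : L)
    (hTi : InfClosed T) (hUs : SupClosed (insert x T))
    (hT : ∀ a ∈ T, ∀ b ∈ T, ∀ c ∈ T, a ≤ b ⊔ c ∨ b ≤ a ⊔ c ∨ c ≤ a ⊔ b)
    (b c : L) (hb : b ∈ insert x T) (hc : c ∈ insert x T) :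
    x ≤ b ⊔ c ∨ b ≤ x ⊔ c ∨ c ≤ x ⊔ b := by
  by_contra hcon
  push Not at hcon
  obtain ⟨h1, h2, h3⟩ := hcon
  have hb' : b ∈ T := hb.resolve_left fun e => h1 (e ▸ le_sup_left)
  have hc' : c ∈ T := hc.resolve_left fun e => h1 (e ▸ le_sup_right)
  have hxb : x ⊔ b ∈ T := (hUs (Set.mem_insert x T) hb).resolve_left
    fun e => h2 ((sup_eq_left.1 e).trans le_sup_left)
  have hxc : x ⊔ c ∈ T := (hUs (Set.mem_insert x T) hc).resolve_left
    fun e => h3 ((sup_eq_left.1 e).trans le_sup_left)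
  rcases hT _ (hTi hxb hxc) b hb' c hc' with h | h | h
  · exact h1 ((le_inf le_sup_left le_sup_left).trans h)
  · exact h2 (h.trans (sup_le inf_le_right le_sup_right))
  · exact h3 (h.trans (sup_le inf_le_left le_sup_right))

theorem noTriple_of_dismantle {L : Type*} [Lattice L] (n : ℕ) (a : Fin n → L)
    (hsurj : Function.Surjective a)
    (ha : ∀ k : Fin n,
          SupClosed {x : L | ∃ i ≤ k, a i = x} ∧ InfClosed {x : L | ∃ i ≤ k, a i = x}) :
    NoTriple L := by
  have main : ∀ k : ℕ, k ≤ n → ∀ p ∈ {x : L | ∃ i : Fin n, i.1 < k ∧ a i = x},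
      ∀ q ∈ {x : L | ∃ i : Fin n, i.1 < k ∧ a i = x},
      ∀ r ∈ {x : L | ∃ i : Fin n, i.1 < k ∧ a i = x},
      p ≤ q ⊔ r ∨ q ≤ p ⊔ r ∨ r ≤ p ⊔ q := by
    intro k
    induction k with
    | zero =>
      rintro _ p ⟨i, hi, _⟩
      omega
    | succ k ih =>
      intro hk
      have ih := ih (by omega)
      have hset : ∀ j (hj : j < n), {x : L | ∃ i ≤ (⟨j, hj⟩ : Fin n), a i = x} =
          {x : L | ∃ i : Fin n, i.1 < j + 1 ∧ a i = x} := by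
        intro j hj
        ext y
        simp only [Set.mem_setOf_eq, Fin.le_def, Nat.lt_succ_iff]
      have hins : {x : L | ∃ i : Fin n, i.1 < k + 1 ∧ a i = x} =
          insert (a ⟨k, hk⟩) {x : L | ∃ i : Fin n, i.1 < k ∧ a i = x} := by
        ext y
        simp only [Set.mem_setOf_eq, Set.mem_insert_iff]
        constructor
        · rintro ⟨i, hi, rfl⟩
          rcases Nat.lt_succ_iff_lt_or_eq.1 hi with h | h
          · exact Or.inr ⟨i, h, rfl⟩
          · exact Or.inl (congrArg a (Fin.ext h))
        · rintro (rfl | ⟨i, hi, rfl⟩)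
          · exact ⟨⟨k, hk⟩, Nat.lt_succ_self k, rfl⟩
          · exact ⟨i, by omega, rfl⟩
      have hinf : InfClosed {x : L | ∃ i : Fin n, i.1 < k ∧ a i = x} := by
        cases k with
        | zero =>
          rintro p ⟨i, hi, _⟩
          omega
        | succ j =>
          rw [← hset j (by omega)]
          exact (ha _).2
      have hsup := (ha ⟨k, hk⟩).1
      rw [hset k hk, hins] at hsup
      rw [hins]
      have st := step _ _ hinf hsup ih
      intro p hp q hq r hr
      rcases hp with rfl | hp'
      · exact st q r hq hr
      rcases hq with rfl | hq'
      · rcases st p r (Or.inr hp') hr with h | h | h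
        · exact Or.inr (Or.inl h)
        · exact Or.inl h
        · exact Or.inr (Or.inr (by rwa [sup_comm]))
      rcases hr with rfl | hr'
      · rcases st p q (Or.inr hp') (Or.inr hq') with h | h | h
        · exact Or.inr (Or.inr h)
        · exact Or.inl (by rwa [sup_comm])
        · exact Or.inr (Or.inl (by rwa [sup_comm]))
      exact ih p hp' q hq' r hr'
  intro p q r
  have hmem : ∀ y, y ∈ {x : L | ∃ i : Fin n, i.1 < n ∧ a i = x} := by
    intro y
    obtain ⟨i, hi⟩ := hsurj y
    exact ⟨i, i.2, hi⟩
  exact main n le_rfl p (hmem p) q (hmem q) r (hmem r)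

theorem stmt16 {L : Type*} [Lattice L] [Fintype L]
    (hSDj : ∀ a b c : L, a ⊔ b = a ⊔ c → a ⊔ b = a ⊔ (b ⊓ c)) :
    (∃ a : Fin (Fintype.card L) → L, Function.Bijective a ∧
        ∀ k : Fin (Fintype.card L),
          SupClosed {x : L | ∃ i ≤ k, a i = x} ∧ InfClosed {x : L | ∃ i ≤ k, a i = x}) ↔
      (∀ (S : Finset L) (hS : S.Nonempty), ∃ (S' : Finset L) (hS' : S'.Nonempty),
        S' ⊆ S ∧ S'.card ≤ 2 ∧ S'.sup' hS' id = S.sup' hS id) := by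
  classical
  constructor
  · rintro ⟨a, hbij, ha⟩ S hS
    obtain ⟨p, hp, q, hq, h⟩ :=
      breadth_of_noTriple (noTriple_of_dismantle _ a hbij.2 ha) S hS
    refine ⟨{p, q}, by simp, ?_, Finset.card_le_two, ?_⟩
    · intro y hy
      simp only [Finset.mem_insert, Finset.mem_singleton] at hy
      rcases hy with rfl | rfl <;> assumption
    · rw [← h]
      simp [Finset.sup'_insert]
  · intro h
    obtain ⟨a, hbij, ha⟩ := dismantle (Fintype.card L) L hSDj (noTriple_of_breadth h)
      Nat.card_eq_fintype_card
    refine ⟨a, hbij, fun k => ⟨?_, ?_⟩⟩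
    · rintro _ ⟨i, hi, rfl⟩ _ ⟨j, hj, rfl⟩
      exact (ha k i j hi hj).1
    · rintro _ ⟨i, hi, rfl⟩ _ ⟨j, hj, rfl⟩
      exact (ha k i j hi hj).2
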